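/- arXiv:1912.09298 — 2 statements merged into one kernel-verified Lean document; each statement's English description precedes it below -/
import Mathlib

section
/- Let d ≥ 1 and let Φ be a finite set of atomic τ₀-constraints over variables v₁,…,v_d that is simultaneously satisfiable in ℚ. Then Φ, interpreted in ℚ ×ₗₑₓ ℚ, has a simultaneous solution with all values in D_{Φ,d} := (−C^⋆_{Φ,d}) ∪ {0} ∪ C^⋆_{Φ,d}, where C^⋆_{Φ,d} := { x + n·x·ε : x ∈ C_{Φ,d}, n ∈ ℤ, −d ≤ n ≤ d } and −C^⋆_{Φ,d} := { −y : y ∈ C^⋆_{Φ,d} }. -/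
/-- An atomic `τ₀`-constraint over variables `v₁,…,v_d`: one of the forms
`c₁·v_i σ c₂·v_j`, `c·v_i σ k`, or `k σ c·v_i`, where `σ ∈ {<,=}` is encoded by
the Boolean `strict` (`true` for `<`, `false` for `=`). -/
inductive Atom (d : ℕ) : Type
  | vv (c₁ c₂ : ℚ) (i j : Fin d) (strict : Bool)
  | vk (c k : ℚ) (i : Fin d) (strict : Bool)
  | kv (k c : ℚ) (i : Fin d) (strict : Bool)
  deriving DecidableEq

/-- Well-formedness: the coefficients are nonzero and, in two-variable
constraints, not both negative. -/
def Atom.WellFormed {d : ℕ} : Atom d → Prop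
  | .vv c₁ c₂ _ _ _ => c₁ ≠ 0 ∧ c₂ ≠ 0 ∧ ¬(c₁ < 0 ∧ c₂ < 0)
  | .vk c _ _ _ => c ≠ 0
  | .kv _ c _ _ => c ≠ 0

/-- Satisfaction of an atomic constraint in `ℚ` under the assignment `x`,
where the strict symbol `<` is interpreted by the relation `lt` (take
`(· < ·)` for the constraint itself, and `(· ≤ ·)` for its closure). -/
def Atom.Holds {d : ℕ} (lt : ℚ → ℚ → Prop) (x : Fin d → ℚ) : Atom d → Prop
  | .vv c₁ c₂ i j s => if s then lt (c₁ * x i) (c₂ * x j) else c₁ * x i = c₂ * x j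
  | .vk c k i s => if s then lt (c * x i) k else c * x i = k
  | .kv k c i s => if s then lt k (c * x i) else k = c * x i

/-- `H(Φ) := {c₁/c₂ : some constraint c₁·v_i σ c₂·v_j is in Φ}`. -/
def Hset {d : ℕ} (Φ : Finset (Atom d)) : Set ℚ :=
  { h | ∃ c₁ c₂ i j s, Atom.vv c₁ c₂ i j s ∈ Φ ∧ h = c₁ / c₂ }

/-- `K(Φ) := {k/c : some constraint c·v_i σ k or k σ c·v_i is in Φ}`. -/
def Kset {d : ℕ} (Φ : Finset (Atom d)) : Set ℚ :=
  { q | ∃ c k i s, (Atom.vk c k i s ∈ Φ ∨ Atom.kv k c i s ∈ Φ) ∧ q = k / c }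

/-- `C_{Φ,d} := { |k|·∏_{r=1}^s |h_r|^{e_r} : k ∈ K(Φ) ∪ {1}, e ∈ ℤ^s,
Σ_r |e_r| < d }`, where `h₁,…,h_s` is an enumeration of `H(Φ)`. -/
def Cset {d : ℕ} (Φ : Finset (Atom d)) : Set ℚ :=
  { x | ∃ k : ℚ, (k ∈ Kset Φ ∨ k = 1) ∧
      ∃ (s : ℕ) (h : Fin s → ℚ) (e : Fin s → ℤ),
        Function.Injective h ∧ (∀ q, q ∈ Hset Φ ↔ ∃ r, h r = q) ∧
        (∑ r, (e r).natAbs) < d ∧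
        x = |k| * ∏ r, |h r| ^ (e r) }

/-- The embedding `q ↦ q + 0ε` of `ℚ` into `ℚ ×ₗₑₓ ℚ`. -/
def qlex (q : ℚ) : ℚ ×ₗ ℚ := toLex (q, 0)

/-- Componentwise scalar multiplication `c·(x,y) = (cx, cy)` on `ℚ ×ₗₑₓ ℚ`. -/
def qsmul (c : ℚ) (p : ℚ ×ₗ ℚ) : ℚ ×ₗ ℚ := toLex (c * (ofLex p).1, c * (ofLex p).2)

/-- Satisfaction of an atomic `τ₀`-constraint in `ℚ ×ₗₑₓ ℚ`, where `<` is the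
lexicographic order, rational constants `k` are read as `k + 0ε`, and `c·` is
componentwise scalar multiplication. -/
def Atom.HoldsLex {d : ℕ} (x : Fin d → ℚ ×ₗ ℚ) : Atom d → Prop
  | .vv c₁ c₂ i j s =>
      if s then qsmul c₁ (x i) < qsmul c₂ (x j) else qsmul c₁ (x i) = qsmul c₂ (x j)
  | .vk c k i s => if s then qsmul c (x i) < qlex k else qsmul c (x i) = qlex k
  | .kv k c i s => if s then qlex k < qsmul c (x i) else qlex k = qsmul c (x i)

/-- `C^⋆_{Φ,d} := { x + n·x·ε : x ∈ C_{Φ,d}, n ∈ ℤ, −d ≤ n ≤ d } ⊆ ℚ ×ₗₑₓ ℚ`,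
where `x + n·x·ε` is the pair `(x, n·x)`. -/
def CstarSet {d : ℕ} (Φ : Finset (Atom d)) : Set (ℚ ×ₗ ℚ) :=
  { p | ∃ x ∈ Cset Φ, ∃ n : ℤ, -(d : ℤ) ≤ n ∧ n ≤ d ∧ p = toLex (x, (n : ℚ) * x) }

/-- `D_{Φ,d} := (−C^⋆_{Φ,d}) ∪ {0} ∪ C^⋆_{Φ,d}`. -/
def Dset {d : ℕ} (Φ : Finset (Atom d)) : Set (ℚ ×ₗ ℚ) :=
  { p | (∃ q ∈ CstarSet Φ, p = toLex (-(ofLex q).1, -(ofLex q).2)) ∨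
        p = toLex ((0 : ℚ), (0 : ℚ)) ∨ p ∈ CstarSet Φ }

abbrev GG : Type := {q : ℚ // 0 < q} ×ₗ Multiplicative ℤ

noncomputable def gmk (a : ℚ) (ha : 0 < a) (n : ℤ) : GG := toLex (⟨a, ha⟩, Multiplicative.ofAdd n)

theorem gmk_surj (g : GG) : ∃ a ha n, g = gmk a ha n :=
  ⟨(ofLex g).1.1, (ofLex g).1.2, Multiplicative.toAdd (ofLex g).2, rfl⟩

theorem gmk_mul (a b : ℚ) (ha hb) (n m : ℤ) :
    gmk a ha n * gmk b hb m = gmk (a * b) (mul_pos ha hb) (n + m) := rfl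

theorem gmk_one : (1 : GG) = gmk 1 one_pos 0 := rfl

theorem gmk_inv (a : ℚ) (ha) (n : ℤ) :
    (gmk a ha n)⁻¹ = gmk a⁻¹ (inv_pos.2 ha) (-n) := rfl

theorem gmk_le (a b : ℚ) (ha hb) (n m : ℤ) :
    gmk a ha n ≤ gmk b hb m ↔ a < b ∨ (a = b ∧ n ≤ m) := by
  unfold gmk
  rw [Prod.Lex.toLex_le_toLex]
  simp [Subtype.ext_iff]

theorem gmk_congr {a b : ℚ} {ha : 0 < a} {hb : 0 < b} {n m : ℤ} (h : a = b) (h' : n = m) :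
    gmk a ha n = gmk b hb m := by subst h h'; rfl

theorem choose_t {G : Type*} [CommGroup G] [LinearOrder G] (P : Finset G)
    (hP : P.Nonempty) : ∃ t ∈ P, ∀ p ∈ P, (1 ≤ p → t ≤ p) ∧ (p ≤ 1 → p ≤ t) := by
  by_cases h : (P.filter (fun p => 1 ≤ p)).Nonempty
  · have hm := Finset.min'_mem _ h
    rw [Finset.mem_filter] at hm
    refine ⟨_, hm.1, fun p hp => ⟨fun h1 => Finset.min'_le _ _ (by simp [hp, h1]),
      fun h1 => h1.trans hm.2⟩⟩
  · refine ⟨P.max' hP, P.max'_mem hP, fun p hp => ⟨fun h1 => ?_, fun _ => P.le_max' p hp⟩⟩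
    exact absurd ⟨p, by simp [hp, h1]⟩ h

def RR {G : Type*} [CommGroup G] (W B : Finset G) (n : ℕ) (g : G) : Prop :=
  ∃ b ∈ B, ∃ l : List G, l.length < n ∧ (∀ w ∈ l, w ∈ W) ∧ g = b * l.prod

theorem RR_mono {G : Type*} [CommGroup G] {W B : Finset G} {n m : ℕ} (h : n ≤ m) {g : G}
    (hg : RR W B n g) : RR W B m g := by
  obtain ⟨b, hb, l, hl, h1, h2⟩ := hg
  exact ⟨b, hb, l, by omega, h1, h2⟩

theorem abstract_lemma {G : Type*} [CommGroup G] [LinearOrder G] [IsOrderedMonoid G]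
    {d : ℕ} (W B : Finset G) (hW : ∀ w ∈ W, w⁻¹ ∈ W) (hB : 1 ∈ B) (u : Fin d → G) (m : ℕ)
    (hm : m ≤ d) :
    ∃ v : Fin d → G, (∀ i j, ∀ w ∈ W, u i ≤ w * u j → v i ≤ w * v j) ∧
      (∀ i, ∀ b ∈ B, (u i ≤ b → v i ≤ b) ∧ (b ≤ u i → b ≤ v i)) ∧
      ∃ S : Finset (Fin d), S.card = m ∧ ∀ i ∈ S, RR W B m (v i) := by
  classical
  induction m with
  | zero => exact ⟨u, fun _ _ _ _ h => h, fun _ _ _ => ⟨id, id⟩, ∅, rfl, by simp⟩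
  | succ m ih =>
    obtain ⟨v, h1, h2, S, hS, hR⟩ := ih (by omega)
    obtain ⟨i0, hi0⟩ : ∃ i, i ∉ S := by
      by_contra! h
      have : S = Finset.univ := by ext; simp [h]
      rw [this] at hS; simp at hS; omega
    let P : Finset G :=
      (((Finset.univ \ S) ×ˢ S ×ˢ W).image (fun q => q.2.2 * v q.2.1 / v q.1)) ∪
      (((Finset.univ \ S) ×ˢ B).image (fun q => q.2 / v q.1))
    have hP1 : ∀ i j w, i ∉ S → j ∈ S → w ∈ W → w * v j / v i ∈ P := by
      intro i j w hi hj hw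
      refine Finset.mem_union_left _ (Finset.mem_image.2 ⟨(i, j, w), ?_, rfl⟩)
      simp [hi, hj, hw]
    have hP2 : ∀ i b, i ∉ S → b ∈ B → b / v i ∈ P := by
      intro i b hi hb
      refine Finset.mem_union_right _ (Finset.mem_image.2 ⟨(i, b), ?_, rfl⟩)
      simp [hi, hb]
    obtain ⟨t, ht, htP⟩ := choose_t P ⟨_, hP2 i0 1 hi0 hB⟩
    let v' : Fin d → G := fun i => if i ∈ S then v i else t * v i
    have hv1 : ∀ i, i ∈ S → v' i = v i := fun i hi => by simp [v', hi]
    have hv2 : ∀ i, i ∉ S → v' i = t * v i := fun i hi => by simp [v', hi]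
    refine ⟨v', ?_, ?_, ?_⟩
    · intro i j w hw hu
      have hv := h1 i j w hw hu
      by_cases hi : i ∈ S <;> by_cases hj : j ∈ S
      · rw [hv1 i hi, hv1 j hj]; exact hv
      · rw [hv1 i hi, hv2 j hj]
        have := (htP _ (hP1 j i w⁻¹ hj hi (hW w hw))).2 (by
          rw [div_le_one', inv_mul_le_iff_le_mul]; exact hv)
        rw [div_le_iff_le_mul, inv_mul_le_iff_le_mul] at this
        exact this
      · rw [hv2 i hi, hv1 j hj]
        have := (htP _ (hP1 i j w hi hj hw)).1 (by rw [one_le_div']; exact hv)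
        rwa [le_div_iff_mul_le] at this
      · rw [hv2 i hi, hv2 j hj, mul_left_comm]
        exact mul_le_mul_right hv t
    · intro i b hb
      have hv := h2 i b hb
      by_cases hi : i ∈ S
      · rw [hv1 i hi]; exact hv
      · rw [hv2 i hi]
        have hp := htP _ (hP2 i b hi hb)
        rw [one_le_div', div_le_one', le_div_iff_mul_le, div_le_iff_le_mul] at hp
        exact ⟨fun h => hp.1 (hv.1 h), fun h => hp.2 (hv.2 h)⟩
    · obtain ⟨i, hi, hr⟩ : ∃ i, i ∉ S ∧ RR W B (m+1) (t * v i) := by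
        rcases Finset.mem_union.1 ht with h | h
        · obtain ⟨⟨i, j, w⟩, hq, rfl⟩ := Finset.mem_image.1 h
          simp at hq
          refine ⟨i, hq.1, ?_⟩
          obtain ⟨b, hb, l, hl, hl1, hl2⟩ := hR j hq.2.1
          refine ⟨b, hb, w :: l, by simpa using hl, ?_, ?_⟩
          · intro x hx
            rcases List.mem_cons.1 hx with rfl | hx
            · exact hq.2.2
            · exact hl1 _ hx
          · simp [hl2, mul_left_comm]
        · obtain ⟨⟨i, b⟩, hq, rfl⟩ := Finset.mem_image.1 h
          simp at hq
          exact ⟨i, hq.1, b, hq.2, [], by simp, by simp, by simp⟩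
      refine ⟨insert i S, by simp [hi, hS], ?_⟩
      intro j hj
      by_cases hjS : j ∈ S
      · rw [hv1 j hjS]; exact RR_mono (by omega) (hR j hjS)
      · have : j = i := by simpa [hjS] using hj
        subst this
        rw [hv2 j hjS]; exact hr

theorem generic (α β u v a b : ℚ) (hu : 0 < u) (hv : 0 < v) (ha : 0 < a) (hb : 0 < b) (n m : ℤ)
    (H : ∀ c (hc : 0 < c), c = |β / α| → ∀ r : ℤ, -1 ≤ r → r ≤ 1 →
      (gmk u hu 0 ≤ gmk c hc r * gmk v hv 0 → gmk a ha n ≤ gmk c hc r * gmk b hb m) ∧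
      (gmk c hc r * gmk v hv 0 ≤ gmk u hu 0 → gmk c hc r * gmk b hb m ≤ gmk a ha n)) :
    (α * u < β * v → α * a < β * b ∨ (α * a = β * b ∧ α * (n * a) < β * (m * b))) ∧
    (α * u = β * v → α * a = β * b ∧ α * (n * a) = β * (m * b)) := by
  simp only [gmk_mul, gmk_le] at H
  rcases lt_trichotomy α 0 with hα | hα | hα <;> rcases lt_trichotomy β 0 with hβ | hβ | hβ
  · have hpos : 0 < β / α := div_pos_of_neg_of_neg hβ hα
    have H' := H (β / α) hpos (abs_of_pos hpos).symm
    obtain ⟨c, hc⟩ : ∃ c, c = β / α := ⟨_, rfl⟩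
    rw [← hc] at H' hpos
    have hβ' : β = c * α := by rw [hc, div_mul_cancel₀]; exact hα.ne
    subst hβ'
    constructor
    · intro h
      have h1 : c * v < u := by
        by_contra! h2
        nlinarith [mul_nonneg_of_nonpos_of_nonpos hα.le (sub_nonpos.2 h2)]
      rcases (H' 1 (by norm_num) le_rfl).2 (Or.inl h1) with h2 | ⟨h2, h3⟩
      · left; nlinarith [mul_neg_of_neg_of_pos hα (sub_pos.2 h2)]
      · right
        have h4 : (m : ℚ) < n := by exact_mod_cast (by omega : m < n)
        subst h2
        refine ⟨by ring, ?_⟩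
        nlinarith [mul_neg_of_neg_of_pos hα (mul_pos ha (sub_pos.2 h4))]
    · intro h
      have h1 : u = c * v := by
        apply mul_left_cancel₀ hα.ne
        rw [h]; ring
      have h0 := H' 0 (by norm_num) (by norm_num)
      have h2 := h0.1 (Or.inr ⟨h1, le_rfl⟩)
      have h3 := h0.2 (Or.inr ⟨h1.symm, le_rfl⟩)
      have h4 : a = c * b ∧ n = m := by
        rcases h2 with h2 | ⟨h2, h5⟩ <;> rcases h3 with h3 | ⟨h3, h6⟩
        · exact absurd h2 (not_lt.2 h3.le)
        · exact absurd h2 (not_lt.2 h3.le)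
        · exact absurd h3 (not_lt.2 h2.le)
        · exact ⟨h2, by omega⟩
      obtain ⟨rfl, rfl⟩ := h4
      exact ⟨by ring, by ring⟩
  · subst hβ
    exact ⟨fun _ => Or.inl (by nlinarith [mul_neg_of_neg_of_pos hα ha]), fun h => by nlinarith [mul_neg_of_neg_of_pos hα hu]⟩
  · exact ⟨fun _ => Or.inl (by nlinarith [mul_neg_of_neg_of_pos hα ha, mul_pos hβ hb]), fun h => by nlinarith [mul_neg_of_neg_of_pos hα hu, mul_pos hβ hv]⟩
  · subst hα
    exact ⟨fun h => by nlinarith [mul_neg_of_neg_of_pos hβ hv], fun h => by nlinarith [mul_neg_of_neg_of_pos hβ hv]⟩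
  · subst hα hβ; simp
  · subst hα
    exact ⟨fun h => Or.inl (by nlinarith [mul_pos hβ hb]), fun h => by nlinarith [mul_pos hβ hv]⟩
  · exact ⟨fun h => by nlinarith [mul_neg_of_neg_of_pos hβ hv, mul_pos hα hu], fun h => by nlinarith [mul_neg_of_neg_of_pos hβ hv, mul_pos hα hu]⟩
  · subst hβ
    exact ⟨fun h => by nlinarith [mul_pos hα hu], fun h => by nlinarith [mul_pos hα hu]⟩
  · have hpos : 0 < β / α := div_pos hβ hα
    have H' := H (β / α) hpos (abs_of_pos hpos).symm
    obtain ⟨c, hc⟩ : ∃ c, c = β / α := ⟨_, rfl⟩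
    rw [← hc] at H' hpos
    have hβ' : β = c * α := by rw [hc, div_mul_cancel₀]; exact hα.ne'
    subst hβ'
    constructor
    · intro h
      have h1 : u < c * v := by
        by_contra! h2
        nlinarith [mul_nonneg hα.le (sub_nonneg.2 h2)]
      rcases (H' (-1) le_rfl (by norm_num)).1 (Or.inl h1) with h2 | ⟨h2, h3⟩
      · left; nlinarith [mul_pos hα (sub_pos.2 h2)]
      · right
        have h4 : (n : ℚ) < m := by exact_mod_cast (by omega : n < m)
        subst h2
        refine ⟨by ring, ?_⟩
        nlinarith [mul_pos hα (mul_pos ha (sub_pos.2 h4))]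
    · intro h
      have h1 : u = c * v := by
        apply mul_left_cancel₀ hα.ne'
        rw [h]; ring
      have h0 := H' 0 (by norm_num) (by norm_num)
      have h2 := h0.1 (Or.inr ⟨h1, le_rfl⟩)
      have h3 := h0.2 (Or.inr ⟨h1.symm, le_rfl⟩)
      have h4 : a = c * b ∧ n = m := by
        rcases h2 with h2 | ⟨h2, h5⟩ <;> rcases h3 with h3 | ⟨h3, h6⟩
        · exact absurd h2 (not_lt.2 h3.le)
        · exact absurd h2 (not_lt.2 h3.le)
        · exact absurd h3 (not_lt.2 h2.le)
        · exact ⟨h2, by omega⟩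
      obtain ⟨rfl, rfl⟩ := h4
      exact ⟨by ring, by ring⟩

theorem Hset_finite {d : ℕ} (Φ : Finset (Atom d)) : (Hset Φ).Finite := by
  refine (Φ.finite_toSet.image (fun a => match a with
    | .vv c₁ c₂ _ _ _ => c₁ / c₂
    | .vk c k _ _ => k / c
    | .kv k c _ _ => k / c)).subset ?_
  rintro h ⟨c₁, c₂, i, j, s, hm, rfl⟩
  exact ⟨_, hm, rfl⟩

theorem Kset_finite {d : ℕ} (Φ : Finset (Atom d)) : (Kset Φ).Finite := by
  refine (Φ.finite_toSet.image (fun a => match a with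
    | .vv c₁ c₂ _ _ _ => c₁ / c₂
    | .vk c k _ _ => k / c
    | .kv k c _ _ => k / c)).subset ?_
  rintro h ⟨c, k, i, s, hm | hm, rfl⟩
  · exact ⟨_, hm, rfl⟩
  · exact ⟨_, hm, rfl⟩

def Gset (Q : Set ℚ) : Set GG :=
  {g | ∃ c ∈ Q, ∃ (hc : 0 < c) (r : ℤ), -1 ≤ r ∧ r ≤ 1 ∧ g = gmk c hc r}

theorem Gset_finite {Q : Set ℚ} (hQ : Q.Finite) : (Gset Q).Finite := by
  classical
  refine ((hQ.prod (Set.finite_Icc (-1 : ℤ) 1)).image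
    (fun p => if h : 0 < p.1 then gmk p.1 h p.2 else 1)).subset ?_
  rintro g ⟨c, hcQ, hc, r, h1, h2, rfl⟩
  exact ⟨(c, r), ⟨hcQ, h1, h2⟩, by simp [hc]⟩

def WQ {d : ℕ} (Φ : Finset (Atom d)) : Set ℚ :=
  (fun q => |q|) '' Hset Φ ∪ (fun q => |q|⁻¹) '' Hset Φ

def BQ {d : ℕ} (Φ : Finset (Atom d)) : Set ℚ :=
  (fun q => |q|) '' (Kset Φ ∪ {1})

theorem prod_form {Q : Set ℚ} {s : ℕ} (h : Fin s → ℚ)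
    (hQ : ∀ q ∈ Q, ∃ r, q = |h r| ∨ q = |h r|⁻¹) (h0 : ∀ r, h r ≠ 0) (l : List GG)
    (hl : ∀ w ∈ l, w ∈ Gset Q) :
    ∃ (e : Fin s → ℤ) (c : ℚ) (hc : 0 < c) (n : ℤ), (∑ r, (e r).natAbs) ≤ l.length ∧
      c = ∏ r, |h r| ^ (e r) ∧ -(l.length : ℤ) ≤ n ∧ n ≤ l.length ∧ l.prod = gmk c hc n := by
  induction l with
  | nil => exact ⟨0, 1, one_pos, 0, by simp, by simp, by simp, by simp, rfl⟩
  | cons w l ih =>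
    obtain ⟨e, c, hc, n, he, rfl, hn1, hn2, hp⟩ := ih (fun w hw => hl w (by simp [hw]))
    obtain ⟨q, hq, hq0, r, hr1, hr2, rfl⟩ := hl w (by simp)
    obtain ⟨r0, hr0⟩ := hQ q hq
    obtain ⟨z, hz, hqz⟩ : ∃ z : ℤ, z.natAbs = 1 ∧ q = |h r0| ^ z := by
      rcases hr0 with rfl | rfl
      · exact ⟨1, rfl, by simp⟩
      · exact ⟨-1, rfl, by simp⟩
    refine ⟨e + Pi.single r0 z, _, mul_pos hq0 hc, r + n, ?_, ?_, ?_, ?_, ?_⟩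
    · have h1 : ∑ i, ((Pi.single r0 z : Fin s → ℤ) i).natAbs = 1 := by
        rw [Finset.sum_eq_single r0]
        · simp [hz]
        · intro b _ hb; simp [hb]
        · simp
      calc _ ≤ ∑ i, ((e i).natAbs + ((Pi.single r0 z : Fin s → ℤ) i).natAbs) :=
            Finset.sum_le_sum (fun i _ => Int.natAbs_add_le _ _)
        _ ≤ _ := by rw [Finset.sum_add_distrib, h1]; simpa using he
    · have h1 : ∏ i, |h i| ^ ((Pi.single r0 z : Fin s → ℤ) i) = q := by
        rw [Finset.prod_eq_single r0]
        · simp [hqz]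
        · intro b _ hb; simp [hb]
        · simp
      rw [← h1, ← Finset.prod_mul_distrib]
      refine Finset.prod_congr rfl fun i _ => ?_
      rw [Pi.add_apply, zpow_add₀ (abs_ne_zero.2 (h0 i)), mul_comm]
    · simp; omega
    · simp; omega
    · rw [List.prod_cons, hp, gmk_mul]

theorem enum_exists {S : Set ℚ} (hS : S.Finite) :
    ∃ (s : ℕ) (h : Fin s → ℚ), Function.Injective h ∧ ∀ q, q ∈ S ↔ ∃ r, h r = q := by
  have e := hS.toFinset.equivFin
  refine ⟨_, fun r => (e.symm r : ℚ), fun a b hab => e.symm.injective (Subtype.ext hab), ?_⟩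
  intro q
  constructor
  · intro hq
    exact ⟨e ⟨q, by simpa using hq⟩, by simp⟩
  · rintro ⟨r, rfl⟩
    exact hS.mem_toFinset.1 (e.symm r).2

theorem Hset_ne {d : ℕ} (Φ : Finset (Atom d)) (hwf : ∀ a ∈ Φ, a.WellFormed) :
    ∀ q ∈ Hset Φ, q ≠ 0 := by
  rintro q ⟨c₁, c₂, i, j, s, hm, rfl⟩
  have := hwf _ hm
  exact div_ne_zero this.1 this.2.1

theorem RR_form {d : ℕ} (Φ : Finset (Atom d)) (hwf : ∀ a ∈ Φ, a.WellFormed) (W B : Finset GG)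
    (hW : ∀ w ∈ W, w ∈ Gset (WQ Φ)) (hB : ∀ w ∈ B, w ∈ Gset (BQ Φ)) (g : GG)
    (hg : RR W B d g) : ∃ (c : ℚ) (hc : 0 < c) (n : ℤ), g = gmk c hc n ∧ c ∈ Cset Φ ∧
      -(d : ℤ) ≤ n ∧ n ≤ d := by
  obtain ⟨s, h, hinj, hh⟩ := enum_exists (Hset_finite Φ)
  obtain ⟨b, hb, l, hl, hlW, rfl⟩ := hg
  obtain ⟨q, ⟨k, hk, rfl⟩, hq0, r, hr1, hr2, rfl⟩ := hB b hb
  obtain ⟨e, c, hc, n, he, hce, hn1, hn2, hp⟩ := prod_form (Q := WQ Φ) h (by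
    rintro q (⟨q, hq, rfl⟩ | ⟨q, hq, rfl⟩)
    · obtain ⟨r, rfl⟩ := (hh q).1 hq
      exact ⟨r, Or.inl rfl⟩
    · obtain ⟨r, rfl⟩ := (hh q).1 hq
      exact ⟨r, Or.inr rfl⟩) (fun r => Hset_ne Φ hwf _ ((hh _).2 ⟨r, rfl⟩)) l
      (fun w hw => hW w (hlW w hw))
  refine ⟨_, mul_pos hq0 hc, r + n, by rw [hp, gmk_mul], ?_, by omega, by omega⟩
  exact ⟨k, hk, s, h, e, hinj, hh, by omega, by rw [hce]⟩

theorem lex_lt (a b c e : ℚ) : (toLex (a, b) : ℚ ×ₗ ℚ) < toLex (c, e) ↔ a < c ∨ a = c ∧ b < e := by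
  rw [Prod.Lex.toLex_lt_toLex]

theorem sign_facts (x : ℚ) : ∃ s : ℚ, ∃ u : ℚ, 0 < u ∧ x = s * u ∧ (x ≠ 0 → |s| = 1) ∧
    (s = 1 ∨ s = 0 ∨ s = -1) := by
  rcases lt_trichotomy x 0 with h | h | h
  · exact ⟨-1, -x, by linarith, by ring, by simp, by simp⟩
  · exact ⟨0, 1, one_pos, by simp [h], by simp [h], by simp⟩
  · exact ⟨1, x, h, by ring, by simp, by simp⟩

/-- If a finite set `Φ` of atomic `τ₀`-constraints over `v₁,…,v_d` is
simultaneously satisfiable in `ℚ`, then `Φ`, interpreted in `ℚ ×ₗₑₓ ℚ`, has a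
simultaneous solution with all values in `D_{Φ,d}`. -/
theorem satisfiable_in_Dset {d : ℕ} (hd : 1 ≤ d) (Φ : Finset (Atom d))
    (hwf : ∀ a ∈ Φ, a.WellFormed)
    (hsat : ∃ x : Fin d → ℚ, ∀ a ∈ Φ, a.Holds (· < ·) x) :
    ∃ y : Fin d → ℚ ×ₗ ℚ, (∀ i, y i ∈ Dset Φ) ∧ ∀ a ∈ Φ, a.HoldsLex y := by
  obtain ⟨x, hx⟩ := hsat
  choose s u hu hsu _ hs using fun i => sign_facts (x i)
  have fW : (Gset (WQ Φ)).Finite :=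
    Gset_finite (((Hset_finite Φ).image _).union ((Hset_finite Φ).image _))
  have fB : (Gset (BQ Φ)).Finite :=
    Gset_finite (((Kset_finite Φ).union (Set.finite_singleton 1)).image _)
  obtain ⟨v, h1, h2, S, hS, hR⟩ := abstract_lemma fW.toFinset fB.toFinset (by
      intro w hw
      rw [Set.Finite.mem_toFinset] at hw ⊢
      obtain ⟨c, hcQ, hc, r, hr1, hr2, rfl⟩ := hw
      refine ⟨c⁻¹, ?_, inv_pos.2 hc, -r, by omega, by omega, gmk_inv _ _ _⟩
      rcases hcQ with ⟨q, hq, rfl⟩ | ⟨q, hq, rfl⟩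
      · exact Or.inr ⟨q, hq, rfl⟩
      · exact Or.inl ⟨q, hq, by simp⟩) (by
      rw [Set.Finite.mem_toFinset]
      exact ⟨1, ⟨1, by simp, by simp⟩, one_pos, 0, by simp, by simp, gmk_one⟩)
    (fun i => gmk (u i) (hu i) 0) d le_rfl
  have hSu : S = Finset.univ := by
    rw [← Finset.card_eq_iff_eq_univ, hS, Fintype.card_fin]
  subst hSu
  choose a ha n hv haC hn1 hn2 using fun i => RR_form Φ hwf _ _
    (fun w hw => fW.mem_toFinset.1 hw) (fun w hw => fB.mem_toFinset.1 hw) (v i)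
    (hR i (Finset.mem_univ i))
  simp only [Set.Finite.mem_toFinset, hv] at h1 h2
  -- two-variable constraints
  have key : ∀ c₁ c₂ i j st, Atom.vv c₁ c₂ i j st ∈ Φ → _ := fun c₁ c₂ i j st hm =>
    generic (c₁ * s i) (c₂ * s j) (u i) (u j) (a i) (a j) (hu i) (hu j) (ha i) (ha j) (n i) (n j)
    (by
      intro c hc hce r hr1 hr2
      have hsi : |s i| = 1 := by
        rcases hs i with h | h | h
        · simp [h]
        · simp [h] at hce; exact absurd hce hc.ne'
        · simp [h]
      have hsj : |s j| = 1 := by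
        rcases hs j with h | h | h
        · simp [h]
        · simp [h] at hce; exact absurd hce hc.ne'
        · simp [h]
      have hce' : c = |c₁ / c₂|⁻¹ := by
        rw [hce]; simp [abs_div, abs_mul, hsi, hsj]
      have hH : c₁ / c₂ ∈ Hset Φ := ⟨c₁, c₂, i, j, st, hm, rfl⟩
      have hm1 : gmk c hc r ∈ Gset (WQ Φ) :=
        ⟨c, Or.inr ⟨_, hH, hce'.symm⟩, hc, r, hr1, hr2, rfl⟩
      have hm2 : (gmk c hc r)⁻¹ ∈ Gset (WQ Φ) :=
        ⟨c⁻¹, Or.inl ⟨_, hH, by simp [hce']⟩, inv_pos.2 hc, -r, by omega, by omega, gmk_inv _ _ _⟩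
      refine ⟨h1 i j _ hm1, fun h => ?_⟩
      have := h1 j i _ hm2 (by rwa [le_inv_mul_iff_mul_le])
      rwa [le_inv_mul_iff_mul_le] at this)
  have keyk : ∀ k c i, k / c ∈ Kset Φ → ∀ q (hq : 0 < q), q = |k / c| → ∀ r : ℤ, -1 ≤ r → r ≤ 1 →
      (gmk (u i) (hu i) 0 ≤ gmk q hq r → gmk (a i) (ha i) (n i) ≤ gmk q hq r) ∧
      (gmk q hq r ≤ gmk (u i) (hu i) 0 → gmk q hq r ≤ gmk (a i) (ha i) (n i)) := by
    intro k c i hK q hq hqe r hr1 hr2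
    exact h2 i _ ⟨q, ⟨_, Or.inl hK, hqe.symm⟩, hq, r, hr1, hr2, rfl⟩
  have keyvk : ∀ c k i, k / c ∈ Kset Φ → _ := fun c k i hK =>
    generic (c * s i) k (u i) 1 (a i) 1 (hu i) one_pos (ha i) one_pos (n i) 0
    (by
      intro q hq hqe r hr1 hr2
      have hsi : |s i| = 1 := by
        rcases hs i with h | h | h
        · simp [h]
        · simp [h] at hqe; exact absurd hqe hq.ne'
        · simp [h]
      rw [← gmk_one, mul_one]
      exact keyk k c i hK q hq (by rw [hqe]; simp [abs_div, abs_mul, hsi]) r hr1 hr2)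
  have keykv : ∀ c k i, k / c ∈ Kset Φ → _ := fun c k i hK =>
    generic k (c * s i) 1 (u i) 1 (a i) one_pos (hu i) one_pos (ha i) 0 (n i)
    (by
      intro q hq hqe r hr1 hr2
      have hsi : |s i| = 1 := by
        rcases hs i with h | h | h
        · simp [h]
        · simp [h] at hqe; exact absurd hqe hq.ne'
        · simp [h]
      have := keyk k c i hK q⁻¹ (inv_pos.2 hq) (by rw [hqe]; simp [abs_div, abs_mul, hsi])
        (-r) (by omega) (by omega)
      rw [← gmk_inv _ hq] at this
      have e1 : ∀ g h : GG, 1 ≤ g * h ↔ g⁻¹ ≤ h := fun g h => by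
        rw [inv_le_iff_one_le_mul']
      have e2 : ∀ g h : GG, g * h ≤ 1 ↔ h ≤ g⁻¹ := fun g h => by
        rw [← mul_one g⁻¹, le_inv_mul_iff_mul_le]
      simp only [← gmk_one, e1, e2]
      exact ⟨this.2, this.1⟩)
  refine ⟨fun i => toLex (s i * a i, s i * (n i * a i)), ?_, ?_⟩
  · intro i
    have hC : toLex (a i, (n i : ℚ) * a i) ∈ CstarSet Φ :=
      ⟨_, haC i, n i, hn1 i, hn2 i, rfl⟩
    rcases hs i with h | h | h
    · right; right; simpa [h] using hC
    · right; left; simp [h]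
    · left; exact ⟨_, hC, by simp [h]⟩
  · intro at0 hat
    have hxa := hx _ hat
    cases at0 with
    | vv c₁ c₂ i j st =>
      have k1 := key c₁ c₂ i j st hat
      simp only [Atom.Holds, Atom.HoldsLex, qsmul, qlex, hsu, ← mul_assoc, ofLex_toLex, lex_lt,
        EmbeddingLike.apply_eq_iff_eq, Prod.mk.injEq] at hxa k1 ⊢
      cases st
      · simpa using k1.2 (by simpa using hxa)
      · simpa using k1.1 (by simpa using hxa)
    | vk c k i st =>
      have k1 := keyvk c k i ⟨c, k, i, st, Or.inl hat, rfl⟩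
      simp only [Atom.Holds, Atom.HoldsLex, qsmul, qlex, hsu, ← mul_assoc, ofLex_toLex, lex_lt,
        EmbeddingLike.apply_eq_iff_eq, Prod.mk.injEq] at hxa k1 ⊢
      cases st
      · simpa using k1.2 (by simpa using hxa)
      · simpa using k1.1 (by simpa using hxa)
    | kv k c i st =>
      have k1 := keykv c k i ⟨c, k, i, st, Or.inr hat, rfl⟩
      simp only [Atom.Holds, Atom.HoldsLex, qsmul, qlex, hsu, ← mul_assoc, ofLex_toLex, lex_lt,
        EmbeddingLike.apply_eq_iff_eq, Prod.mk.injEq] at hxa k1 ⊢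
      cases st
      · simpa using k1.2 (by simpa using hxa)
      · simpa using k1.1 (by simpa using hxa)
end

section
/- Let d ≥ 1 and let Φ be a finite set of atomic τ₁-constraints over variables v₁,…,v_d, interpreted in ℚ((ε)). Suppose there are l, r ∈ ℚ((ε)) with 0 < l < r such that every simultaneous solution (x₁,…,x_d) ∈ ℚ((ε))^d of Φ satisfies l < x_i < r for all i. Let α₁,…,α_d be rational numbers and u ∈ ℚ^⋆_{−1,1}. If Φ has a simultaneous solution (x₁,…,x_d) ∈ ℚ((ε))^d with Σ_{i=1}^d α_i x_i ≤ u, then Φ has a simultaneous solution (x'₁,…,x'_d) with Σ_{i=1}^d α_i x'_i ≤ u and all x'_i in C^⋆_{Φ,d} := { x + n·x·ε³ : x ∈ C_{Φ,d}, n ∈ ℤ, −d ≤ n ≤ d } ⊆ ℚ^⋆_{−1,4}. -/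
open scoped Classical

/-- `ℚ((ε))`: the field of formal Laurent series over `ℚ`. -/
abbrev Qstar : Type := LaurentSeries ℚ

/-- The leading coefficient of a Laurent series (its coefficient at the least
exponent with nonzero coefficient; `0` for the zero series). -/
noncomputable def lead (a : Qstar) : ℚ := a.coeff a.order

/-- The order on `ℚ((ε))`: `a < b` iff `b - a` is positive, i.e. iff the
leading coefficient of `b - a` is positive. -/
def QstarLt (a b : Qstar) : Prop := 0 < lead (b - a)

/-- The corresponding non-strict order on `ℚ((ε))`. -/
def QstarLe (a b : Qstar) : Prop := QstarLt a b ∨ a = b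

/-- Absolute value on `ℚ((ε))` with respect to this order. -/
noncomputable def qabs (a : Qstar) : Qstar := if QstarLt a 0 then -a else a

/-- The natural embedding of `ℚ` into `ℚ((ε))`. -/
noncomputable def qc (c : ℚ) : Qstar := HahnSeries.C c

/-- The indeterminate `ε`. -/
noncomputable def eps : Qstar := HahnSeries.single (1 : ℤ) (1 : ℚ)

/-- `ℚ^⋆_{m,n}`: the Laurent series all of whose nonzero coefficients lie in
exponents between `m` and `n`. -/
def QstarBand (m n : ℤ) : Set Qstar := { x | ∀ i : ℤ, x.coeff i ≠ 0 → m ≤ i ∧ i ≤ n }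

/-- An atomic `τ₁`-constraint over variables `v₁,…,v_d`: one of the forms
`c₁·v_i σ c₂·v_j`, `c·v_i σ k`, or `k σ c·v_i`, with nonzero rational
coefficients and constants `k ∈ ℚ^⋆_{−1,1}`; `σ ∈ {<,=}` is encoded by the
Boolean `strict` (`true` for `<`, `false` for `=`). -/
inductive Atom1 (d : ℕ) : Type
  | vv (c₁ c₂ : ℚ) (i j : Fin d) (strict : Bool)
  | vk (c : ℚ) (k : Qstar) (i : Fin d) (strict : Bool)
  | kv (k : Qstar) (c : ℚ) (i : Fin d) (strict : Bool)

/-- Well-formedness: coefficients are nonzero, in two-variable constraints not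
both negative, and constants lie in `ℚ^⋆_{−1,1}`. -/
def Atom1.WellFormed {d : ℕ} : Atom1 d → Prop
  | .vv c₁ c₂ _ _ _ => c₁ ≠ 0 ∧ c₂ ≠ 0 ∧ ¬(c₁ < 0 ∧ c₂ < 0)
  | .vk c k _ _ => c ≠ 0 ∧ k ∈ QstarBand (-1) 1
  | .kv k c _ _ => c ≠ 0 ∧ k ∈ QstarBand (-1) 1

/-- Satisfaction of an atomic `τ₁`-constraint in `ℚ((ε))` under the assignment
`x`, where the strict symbol `<` is interpreted by the relation `lt` (take
`QstarLt` for the constraint itself and `QstarLe` for its closure). -/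
def Atom1.Holds {d : ℕ} (lt : Qstar → Qstar → Prop) (x : Fin d → Qstar) :
    Atom1 d → Prop
  | .vv c₁ c₂ i j s =>
      if s then lt (qc c₁ * x i) (qc c₂ * x j) else qc c₁ * x i = qc c₂ * x j
  | .vk c k i s => if s then lt (qc c * x i) k else qc c * x i = k
  | .kv k c i s => if s then lt k (qc c * x i) else k = qc c * x i

/-- `H(Φ) := {c₁/c₂ : some constraint c₁·v_i σ c₂·v_j is in Φ} ⊆ ℚ`. -/
def Hset1 {d : ℕ} (Φ : Finset (Atom1 d)) : Set ℚ :=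
  { h | ∃ c₁ c₂ i j s, Atom1.vv c₁ c₂ i j s ∈ Φ ∧ h = c₁ / c₂ }

/-- `K(Φ) := {k/c : some constraint c·v_i σ k or k σ c·v_i is in Φ} ⊆ ℚ((ε))`. -/
def Kset1 {d : ℕ} (Φ : Finset (Atom1 d)) : Set Qstar :=
  { q | ∃ c k i s, (Atom1.vk c k i s ∈ Φ ∨ Atom1.kv k c i s ∈ Φ) ∧ q = k / qc c }

/-- `C_{Φ,d} := { |k|·∏_{r=1}^s |h_r|^{e_r} : k ∈ K(Φ) ∪ {1}, e ∈ ℤ^s,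
Σ_r |e_r| < d } ⊆ ℚ((ε))`, where `h₁,…,h_s` is an enumeration of `H(Φ)`. -/
def Cset1 {d : ℕ} (Φ : Finset (Atom1 d)) : Set Qstar :=
  { x | ∃ k : Qstar, (k ∈ Kset1 Φ ∨ k = 1) ∧
      ∃ (s : ℕ) (h : Fin s → ℚ) (e : Fin s → ℤ),
        Function.Injective h ∧ (∀ q, q ∈ Hset1 Φ ↔ ∃ r, h r = q) ∧
        (∑ r, (e r).natAbs) < d ∧
        x = qabs k * qc (∏ r, |h r| ^ (e r)) }

/-- `C^⋆_{Φ,d} := { x + n·x·ε³ : x ∈ C_{Φ,d}, n ∈ ℤ, −d ≤ n ≤ d }`. -/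
def CstarSet1 {d : ℕ} (Φ : Finset (Atom1 d)) : Set Qstar :=
  { y | ∃ x ∈ Cset1 Φ, ∃ n : ℤ, -(d : ℤ) ≤ n ∧ n ≤ d ∧
      y = x + qc (n : ℚ) * x * eps ^ 3 }

noncomputable instance instQstarLO : LinearOrder Qstar :=
  inferInstanceAs (LinearOrder (Lex (HahnSeries ℤ ℚ)))

instance instQstarOR : IsStrictOrderedRing Qstar :=
  inferInstanceAs (IsStrictOrderedRing (Lex (HahnSeries ℤ ℚ)))

lemma lead_pos_iff (x : Qstar) : 0 < lead x ↔ 0 < x := by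
  have := HahnSeries.leadingCoeff_pos_iff (x := toLex (x : HahnSeries ℤ ℚ))
  rw [ofLex_toLex, HahnSeries.leadingCoeff_eq] at this
  exact this

lemma qlt_iff (a b : Qstar) : QstarLt a b ↔ a < b := by
  rw [QstarLt, lead_pos_iff, sub_pos]

lemma qle_iff (a b : Qstar) : QstarLe a b ↔ a ≤ b := by
  rw [QstarLe, qlt_iff, le_iff_lt_or_eq]

lemma qc_pos {c : ℚ} : 0 < qc c ↔ 0 < c := by
  rw [← lead_pos_iff, lead, ← HahnSeries.leadingCoeff_eq, qc, HahnSeries.C_apply,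
    HahnSeries.leadingCoeff_of_single]

lemma qc_mul (a b : ℚ) : qc (a * b) = qc a * qc b := map_mul HahnSeries.C a b
lemma qc_one : qc 1 = 1 := map_one HahnSeries.C
lemma qc_ne {c : ℚ} (h : c ≠ 0) : qc c ≠ 0 := by
  intro h'
  exact h (HahnSeries.C_injective (h'.trans (map_zero HahnSeries.C).symm))
lemma qc_inv (a : ℚ) : qc a⁻¹ = (qc a)⁻¹ := map_inv₀ HahnSeries.C a
lemma qc_div (a b : ℚ) : qc (a / b) = qc a / qc b := map_div₀ HahnSeries.C a b

lemma coeff_qc_mul (c : ℚ) (x : Qstar) (n : ℤ) : (qc c * x).coeff n = c * x.coeff n := by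
  rw [qc, HahnSeries.C_mul_eq_smul, HahnSeries.coeff_smul, smul_eq_mul]

lemma band_qc {c : ℚ} {x : Qstar} {m n : ℤ} (h : x ∈ QstarBand m n) :
    qc c * x ∈ QstarBand m n := by
  intro i hi
  rw [coeff_qc_mul] at hi
  exact h i (right_ne_zero_of_mul hi)

lemma band_sub {x y : Qstar} {m n : ℤ} (h : x ∈ QstarBand m n) (h' : y ∈ QstarBand m n) :
    x - y ∈ QstarBand m n := by
  intro i hi
  by_cases hx : x.coeff i = 0
  · by_cases hy : y.coeff i = 0
    · rw [HahnSeries.coeff_sub, hx, hy] at hi; simp at hi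
    · exact h' i hy
  · exact h i hx

lemma band_zero {m n : ℤ} : (0 : Qstar) ∈ QstarBand m n := by
  intro i hi; simp at hi

lemma band_neg {x : Qstar} {m n : ℤ} (h : x ∈ QstarBand m n) :
    - x ∈ QstarBand m n := by
  have := band_sub band_zero h
  rwa [zero_sub] at this

lemma band_add {x y : Qstar} {m n : ℤ} (h : x ∈ QstarBand m n) (h' : y ∈ QstarBand m n) :
    x + y ∈ QstarBand m n := by
  have := band_sub h (band_neg h')
  rwa [sub_neg_eq_add] at this

lemma band_sum {ι : Type*} (s : Finset ι) (f : ι → Qstar) {m n : ℤ}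
    (h : ∀ i, f i ∈ QstarBand m n) : ∑ i ∈ s, f i ∈ QstarBand m n := by
  induction s using Finset.induction_on with
  | empty => simpa using band_zero
  | insert a s ha ih => rw [Finset.sum_insert ha]; exact band_add (h a) ih

lemma eps3 : eps ^ 3 = HahnSeries.single (3 : ℤ) (1 : ℚ) := by
  rw [eps, HahnSeries.single_pow]; simp

lemma eps3_pos : 0 < eps ^ 3 := by
  rw [← lead_pos_iff, lead, ← HahnSeries.leadingCoeff_eq, eps3, HahnSeries.leadingCoeff_of_single]
  norm_num

lemma pos_iff_coeff (x : Qstar) :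
    0 < x ↔ ∃ n : ℤ, (∀ m < n, x.coeff m = 0) ∧ 0 < x.coeff n := by
  have := HahnSeries.lt_iff (toLex (0 : HahnSeries ℤ ℚ)) (toLex (x : HahnSeries ℤ ℚ))
  refine Iff.trans this ?_
  simp [eq_comm]

lemma pos_perturb {y z : Qstar} (hy : y ∈ QstarBand (-1) 1) (hz : z ∈ QstarBand (-1) 1)
    (h : 0 < y) : 0 < y + z * eps ^ 3 := by
  rw [pos_iff_coeff] at h ⊢
  obtain ⟨n, h1, h2⟩ := h
  have hn := (hy n h2.ne').2
  have key : ∀ m ≤ (1 : ℤ), (y + z * eps ^ 3).coeff m = y.coeff m := by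
    intro m hm
    rw [HahnSeries.coeff_add, eps3, HahnSeries.coeff_mul_single, mul_one]
    have : z.coeff (m - 3) = 0 := by
      by_contra hc
      have := (hz _ hc).1
      omega
    rw [this, add_zero]
  refine ⟨n, fun m hm => ?_, ?_⟩
  · rw [key m (by omega), h1 m hm]
  · rw [key n hn]; exact h2

lemma qabs_pos {a : Qstar} (h : 0 < a) : qabs a = a := by
  rw [qabs, qlt_iff, if_neg (not_lt.2 h.le)]

/-! ### generic lemmas -/

lemma line_step {ι K : Type*} [Field K] [LinearOrder K] [IsStrictOrderedRing K]
    (Φ : Finset ι) (a b : ι → K) (ha : ∀ i ∈ Φ, 0 ≤ a i)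
    (hab : ∀ i ∈ Φ, a i = 0 → b i = 0) (hneg : ∃ i ∈ Φ, b i < 0) :
    ∃ t > 0, (∀ i ∈ Φ, 0 ≤ a i + t * b i) ∧ ∃ i ∈ Φ, b i ≠ 0 ∧ a i + t * b i = 0 := by
  obtain ⟨i₀, hi₀, hb₀⟩ := hneg
  obtain ⟨i, hi, hmin⟩ := Finset.exists_min_image (Φ.filter (fun i => b i < 0))
    (fun i => a i / (- b i)) ⟨i₀, by simp [hi₀, hb₀]⟩
  rw [Finset.mem_filter] at hi
  have hai : 0 < a i := lt_of_le_of_ne (ha i hi.1) (fun h => hi.2.ne (hab i hi.1 h.symm))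
  have hbi : 0 < - b i := by linarith [hi.2]
  have ht : 0 < a i / (- b i) := div_pos hai hbi
  refine ⟨a i / (- b i), ht, fun j hj => ?_, i, hi.1, hi.2.ne, ?_⟩
  · rcases lt_or_ge (b j) 0 with h | h
    · have h1 := hmin j (by simp [hj, h])
      have hbj : 0 < - b j := by linarith
      rw [le_div_iff₀ hbj] at h1
      linarith
    · have := mul_nonneg ht.le h
      linarith [ha j hj]
  · have := div_mul_cancel₀ (a i) hbi.ne'
    linarith

lemma small_step {ι K : Type*} [Field K] [LinearOrder K] [IsStrictOrderedRing K]
    (Φ : Finset ι) (a b : ι → K) (ha : ∀ i ∈ Φ, 0 < a i) :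
    ∃ t > 0, ∀ t', 0 < t' → t' ≤ t → ∀ i ∈ Φ, 0 < a i + t' * b i := by
  induction Φ using Finset.induction_on with
  | empty => exact ⟨1, one_pos, by simp⟩
  | insert i Φ hi ih =>
    obtain ⟨t, ht, h⟩ := ih (fun j hj => ha j (Finset.mem_insert_of_mem hj))
    have hai := ha i (Finset.mem_insert_self _ _)
    have hb : 0 < |b i| + 1 := by positivity
    refine ⟨min t (a i / (|b i| + 1)), lt_min ht (div_pos hai hb), fun t' h0 h1 j hj => ?_⟩
    rcases Finset.mem_insert.1 hj with rfl | hj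
    · have h2 := (le_min_iff.1 h1).2
      rw [le_div_iff₀ hb] at h2
      have h3 : t' * (- b j) ≤ t' * |b j| := mul_le_mul_of_nonneg_left (neg_le_abs _) h0.le
      linarith
    · exact h t' h0 (le_min_iff.1 h1).1 j hj

lemma rank_exists {K : Type*} [Field K] [LinearOrder K] [IsStrictOrderedRing K] {d : ℕ}
    (m : Fin d → K) : ∃ n : Fin d → ℤ, (∀ i, -(d : ℤ) ≤ n i ∧ n i ≤ d) ∧
      (∀ i j, m i < m j → n i < n j) ∧ (∀ i j, m i = m j → n i = n j) ∧
      (∀ i, 0 < m i → 0 < n i) ∧ (∀ i, m i < 0 → n i < 0) ∧ (∀ i, m i = 0 → n i = 0) := by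
  let A : Fin d → Finset (Fin d) := fun i => Finset.univ.filter (fun j => 0 < m j ∧ m j ≤ m i)
  let B : Fin d → Finset (Fin d) := fun i => Finset.univ.filter (fun j => m j < 0 ∧ m i ≤ m j)
  have hA : ∀ i, (A i).card ≤ d := fun i => by simpa using Finset.card_le_univ (A i)
  have hB : ∀ i, (B i).card ≤ d := fun i => by simpa using Finset.card_le_univ (B i)
  have hA0 : ∀ i, m i ≤ 0 → (A i).card = 0 := by
    intro i hi
    simp only [A, Finset.card_eq_zero, Finset.filter_eq_empty_iff]
    rintro j - ⟨h1, h2⟩; linarith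
  have hB0 : ∀ i, 0 ≤ m i → (B i).card = 0 := by
    intro i hi
    simp only [B, Finset.card_eq_zero, Finset.filter_eq_empty_iff]
    rintro j - ⟨h1, h2⟩; linarith
  have hAp : ∀ i, 0 < m i → 0 < (A i).card := by
    intro i hi; exact Finset.card_pos.2 ⟨i, by simp [A, hi]⟩
  have hBp : ∀ i, m i < 0 → 0 < (B i).card := by
    intro i hi; exact Finset.card_pos.2 ⟨i, by simp [B, hi]⟩
  have hAs : ∀ i j, m i < m j → 0 < m j → (A i).card < (A j).card := by
    intro i j h h'
    apply Finset.card_lt_card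
    rw [Finset.ssubset_iff_of_subset]
    · exact ⟨j, by simp [A, h'], by simp [A, h]⟩
    · intro k; simp only [A, Finset.mem_filter]
      rintro ⟨h1, h2, h3⟩; exact ⟨h1, h2, by linarith⟩
  have hBs : ∀ i j, m i < m j → m i < 0 → (B j).card < (B i).card := by
    intro i j h h'
    apply Finset.card_lt_card
    rw [Finset.ssubset_iff_of_subset]
    · exact ⟨i, by simp [B, h'], by simp [B, h]⟩
    · intro k; simp only [B, Finset.mem_filter]
      rintro ⟨h1, h2, h3⟩; exact ⟨h1, h2, by linarith⟩
  refine ⟨fun i => (A i).card - (B i).card, fun i => ?_, fun i j h => ?_, fun i j h => ?_,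
    fun i h => ?_, fun i h => ?_, fun i h => ?_⟩ <;> dsimp only
  · have := hA i; have := hB i; omega
  · rcases lt_or_ge 0 (m j) with hj | hj
    · have h1 := hAs i j h hj
      have h2 := hB0 j hj.le
      omega
    · have h1 := hBs i j h (by linarith)
      have h2 := hA0 j hj
      have h3 := hA0 i (by linarith)
      omega
  · simp only [A, B, h]
  · have := hAp i h; have := hB0 i h.le; omega
  · have := hBp i h; have := hA0 i h.le; omega
  · have := hA0 i h.le; have := hB0 i h.ge; omega

/-! ### slack functions -/

noncomputable def slack {d : ℕ} (x : Fin d → Qstar) : Atom1 d → Qstar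
  | .vv c₁ c₂ i j _ => qc c₂ * x j - qc c₁ * x i
  | .vk c k i _ => k - qc c * x i
  | .kv k c i _ => qc c * x i - k

noncomputable def slin {d : ℕ} (x : Fin d → Qstar) : Atom1 d → Qstar
  | .vv c₁ c₂ i j _ => qc c₂ * x j - qc c₁ * x i
  | .vk c _ i _ => - (qc c * x i)
  | .kv _ c i _ => qc c * x i

def isStrict {d : ℕ} : Atom1 d → Prop
  | .vv _ _ _ _ s => s = true
  | .vk _ _ _ s => s = true
  | .kv _ _ _ s => s = true

lemma slack_add {d : ℕ} (x w : Fin d → Qstar) (t : Qstar) (a : Atom1 d) :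
    slack (fun i => x i + t * w i) a = slack x a + t * slin w a := by
  cases a <;> simp only [slack, slin] <;> ring

lemma slin_sub {d : ℕ} (x y : Fin d → Qstar) (a : Atom1 d) :
    slin (fun i => x i - y i) a = slack x a - slack y a := by
  cases a <;> simp only [slack, slin] <;> ring

lemma holds_iff {d : ℕ} (x : Fin d → Qstar) (a : Atom1 d) :
    a.Holds QstarLt x ↔ (isStrict a → 0 < slack x a) ∧ (¬ isStrict a → slack x a = 0) := by
  cases a with
  | vv c₁ c₂ i j s => cases s <;> simp [Atom1.Holds, isStrict, slack, qlt_iff, sub_eq_zero, eq_comm]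
  | vk c k i s => cases s <;> simp [Atom1.Holds, isStrict, slack, qlt_iff, sub_eq_zero, eq_comm]
  | kv k c i s => cases s <;> simp [Atom1.Holds, isStrict, slack, qlt_iff, sub_eq_zero, eq_comm]

def inP {d : ℕ} (Φ : Finset (Atom1 d)) (x : Fin d → Qstar) : Prop :=
  ∀ a ∈ Φ, 0 ≤ slack x a ∧ (¬ isStrict a → slack x a = 0)

def tightG {d : ℕ} (Φ : Finset (Atom1 d)) (v : Fin d → Qstar) : SimpleGraph (Fin d) :=
  SimpleGraph.fromRel (fun i j => ∃ c₁ c₂ s, Atom1.vv c₁ c₂ i j s ∈ Φ ∧ qc c₁ * v i = qc c₂ * v j)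

def tightK {d : ℕ} (Φ : Finset (Atom1 d)) (v : Fin d → Qstar) (j : Fin d) : Prop :=
  ∃ c k s, (Atom1.vk c k j s ∈ Φ ∨ Atom1.kv k c j s ∈ Φ) ∧ qc c * v j = k

def anchored {d : ℕ} (Φ : Finset (Atom1 d)) (v : Fin d → Qstar) : Prop :=
  ∀ i, ∃ j, (tightG Φ v).Reachable i j ∧ tightK Φ v j

lemma inP_bound {d : ℕ} {Φ : Finset (Atom1 d)} {l r : Qstar}
    (hbound : ∀ x : Fin d → Qstar, (∀ a ∈ Φ, a.Holds QstarLt x) →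
      ∀ i, QstarLt l (x i) ∧ QstarLt (x i) r)
    {s : Fin d → Qstar} (hs : ∀ a ∈ Φ, a.Holds QstarLt s)
    {x : Fin d → Qstar} (hx : inP Φ x) (i : Fin d) : l ≤ x i ∧ x i ≤ r := by
  have key : ∀ t : Qstar, 0 < t → t ≤ 1 → l < x i + t * (s i - x i) ∧ x i + t * (s i - x i) < r := by
    intro t h0 h1
    have := hbound (fun i => x i + t * (s i - x i)) ?_ i
    · simpa only [qlt_iff] using this
    · intro a ha
      rw [holds_iff, slack_add x (fun i => s i - x i) t a, slin_sub]
      have h2 := (holds_iff s a).1 (hs a ha)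
      have h3 := hx a ha
      refine ⟨fun h => ?_, fun h => ?_⟩
      · have h4 := mul_pos h0 (h2.1 h)
        have h5 := mul_nonneg (sub_nonneg.2 h1) h3.1
        linarith
      · rw [h2.2 h, h3.2 h]; ring
  have hsi := hbound s hs i
  rw [qlt_iff, qlt_iff] at hsi
  constructor
  · by_contra hc
    push Not at hc
    have hp : 0 < s i - x i := by linarith [hsi.1]
    have := (key ((l - x i) / (s i - x i)) (div_pos (by linarith) hp)
      ((div_le_one hp).2 (by linarith [hsi.1]))).1
    rw [div_mul_cancel₀ _ hp.ne'] at this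
    linarith
  · by_contra hc
    push Not at hc
    have hp : 0 < x i - s i := by linarith [hsi.2]
    have := (key ((x i - r) / (x i - s i)) (div_pos (by linarith) hp)
      ((div_le_one hp).2 (by linarith [hsi.2]))).2
    have h2 := div_mul_cancel₀ (x i - r) hp.ne'
    linarith

lemma vertex_step {d : ℕ} {Φ : Finset (Atom1 d)} {l r : Qstar} (hl : 0 < l)
    (hb : ∀ x, inP Φ x → ∀ i, l ≤ x i ∧ x i ≤ r) (α : Fin d → ℚ)
    (v : Fin d → Qstar) (hv : inP Φ v) (hna : ¬ anchored Φ v) :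
    ∃ v', inP Φ v' ∧ ∑ i, qc (α i) * v' i ≤ ∑ i, qc (α i) * v i ∧
      (Φ.filter (fun a => slack v a = 0)).card < (Φ.filter (fun a => slack v' a = 0)).card := by
  unfold anchored at hna
  push Not at hna
  obtain ⟨i₀, hi₀⟩ := hna
  set G := tightG Φ v with hG
  let w₀ : Fin d → Qstar := fun i => if G.Reachable i₀ i then v i else 0
  obtain ⟨σ, hσ, hσw⟩ : ∃ σ : Qstar, (σ = 1 ∨ σ = -1) ∧ σ * ∑ i, qc (α i) * w₀ i ≤ 0 := by
    rcases le_total (∑ i, qc (α i) * w₀ i) 0 with h | h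
    · exact ⟨1, Or.inl rfl, by simpa using h⟩
    · exact ⟨-1, Or.inr rfl, by simpa using h⟩
  let w : Fin d → Qstar := fun i => σ * w₀ i
  have hpos : ∀ i, 0 < v i := fun i => hl.trans_le (hb v hv i).1
  have hw₀ : w₀ i₀ = v i₀ := if_pos (SimpleGraph.Reachable.refl _)
  have hreach : ∀ i j c₁ c₂ s, Atom1.vv c₁ c₂ i j s ∈ Φ → qc c₁ * v i = qc c₂ * v j →
      (G.Reachable i₀ i ↔ G.Reachable i₀ j) := by
    intro i j c₁ c₂ s hm he
    by_cases hij : i = j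
    · rw [hij]
    · have hadj : G.Adj i j := by
        rw [hG, tightG, SimpleGraph.fromRel_adj]
        exact ⟨hij, Or.inl ⟨c₁, c₂, s, hm, he⟩⟩
      exact ⟨fun h => h.trans hadj.reachable, fun h => h.trans hadj.symm.reachable⟩
  have htight : ∀ a ∈ Φ, slack v a = 0 → slin w a = 0 := by
    intro a ha h0
    cases a with
    | vv c₁ c₂ i j s =>
      simp only [slack, slin, w, w₀] at h0 ⊢
      have he : qc c₁ * v i = qc c₂ * v j := (sub_eq_zero.1 h0).symm
      have := hreach i j c₁ c₂ s ha he
      by_cases hi : G.Reachable i₀ i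
      · rw [if_pos hi, if_pos (this.1 hi)]; linear_combination σ * h0
      · rw [if_neg hi, if_neg (fun h => hi (this.2 h))]; ring
    | vk c k i s =>
      simp only [slack, slin, w, w₀] at h0 ⊢
      rw [if_neg]
      · ring
      · intro hr; exact hi₀ i hr ⟨c, k, s, Or.inl ha, (sub_eq_zero.1 h0).symm⟩
    | kv k c i s =>
      simp only [slack, slin, w, w₀] at h0 ⊢
      rw [if_neg]
      · ring
      · intro hr; exact hi₀ i hr ⟨c, k, s, Or.inr ha, (sub_eq_zero.1 h0)⟩
  have hneg : ∃ a ∈ Φ, slin w a < 0 := by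
    by_contra hc
    push Not at hc
    have hray : ∀ t : Qstar, 0 ≤ t → inP Φ (fun i => v i + t * w i) := by
      intro t ht a ha
      rw [slack_add]
      refine ⟨add_nonneg (hv a ha).1 (mul_nonneg ht (hc a ha)), fun hs => ?_⟩
      have h0 := (hv a ha).2 hs
      rw [h0, htight a ha h0]; ring
    rcases hσ with rfl | rfl
    · have hr : 0 < r := (hpos i₀).trans_le (hb v hv i₀).2
      have := (hb _ (hray (r / v i₀) (div_nonneg hr.le (hpos i₀).le)) i₀).2
      simp only [w, hw₀, one_mul] at this
      rw [div_mul_cancel₀ _ (hpos i₀).ne'] at this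
      linarith [hpos i₀]
    · have := (hb _ (hray 1 zero_le_one) i₀).1
      simp only [w, hw₀] at this
      linarith
  obtain ⟨t, ht, hge, a₀, ha₀, hne, hz⟩ := line_step Φ (slack v) (slin w)
    (fun a ha => (hv a ha).1) htight hneg
  refine ⟨fun i => v i + t * w i, ?_, ?_, ?_⟩
  · intro a ha
    rw [slack_add]
    refine ⟨hge a ha, fun hs => ?_⟩
    have h0 := (hv a ha).2 hs
    rw [h0, htight a ha h0]; ring
  · have : ∑ i, qc (α i) * (v i + t * w i)
        = ∑ i, qc (α i) * v i + t * (σ * ∑ i, qc (α i) * w₀ i) := by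
      rw [Finset.mul_sum, Finset.mul_sum, ← Finset.sum_add_distrib]
      exact Finset.sum_congr rfl (fun i _ => by simp only [w]; ring)
    rw [this]
    have := mul_nonpos_of_nonneg_of_nonpos ht.le hσw
    linarith
  · apply Finset.card_lt_card
    rw [Finset.ssubset_iff_of_subset]
    · refine ⟨a₀, ?_, ?_⟩
      · rw [Finset.mem_filter, slack_add]; exact ⟨ha₀, hz⟩
      · rw [Finset.mem_filter]; exact fun h => hne (htight a₀ ha₀ h.2)
    · intro a
      rw [Finset.mem_filter, Finset.mem_filter, slack_add]
      rintro ⟨h1, h2⟩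
      exact ⟨h1, by rw [h2, htight a h1 h2]; ring⟩

lemma vertex_exists {d : ℕ} {Φ : Finset (Atom1 d)} {l r : Qstar} (hl : 0 < l)
    (hb : ∀ x, inP Φ x → ∀ i, l ≤ x i ∧ x i ≤ r) (α : Fin d → ℚ) (m : ℕ) :
    ∀ (v : Fin d → Qstar) (_ : inP Φ v)
    (_ : Φ.card - (Φ.filter (fun a => slack v a = 0)).card ≤ m),
    ∃ v', inP Φ v' ∧ ∑ i, qc (α i) * v' i ≤ ∑ i, qc (α i) * v i ∧ anchored Φ v' := by
  induction m with
  | zero =>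
    intro v hv hm
    refine ⟨v, hv, le_rfl, ?_⟩
    by_contra hc
    obtain ⟨v', _, _, h3⟩ := vertex_step hl hb α v hv hc
    have := Finset.card_filter_le Φ (fun a => slack v' a = 0)
    omega
  | succ m ih =>
    intro v hv hm
    by_cases hc : anchored Φ v
    · exact ⟨v, hv, le_rfl, hc⟩
    · obtain ⟨v', h1, h2, h3⟩ := vertex_step hl hb α v hv hc
      obtain ⟨v'', h4, h5, h6⟩ := ih v' h1 (by omega)
      exact ⟨v'', h4, h5.trans h2, h6⟩

lemma adj_ratio {d : ℕ} {Φ : Finset (Atom1 d)} (hwf : ∀ a ∈ Φ, a.WellFormed)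
    {v : Fin d → Qstar} (hpos : ∀ i, 0 < v i) {i j : Fin d} (h : (tightG Φ v).Adj i j) :
    ∃ q ∈ Hset1 Φ, 0 < q ∧ ∃ σ : ℤ, σ.natAbs = 1 ∧ v i = v j * qc (q ^ σ) := by
  rw [tightG, SimpleGraph.fromRel_adj] at h
  have main : ∀ i j c₁ c₂ s, Atom1.vv c₁ c₂ i j s ∈ Φ → qc c₁ * v i = qc c₂ * v j →
      0 < c₁ / c₂ ∧ v j = v i * qc (c₁ / c₂) := by
    intro i j c₁ c₂ s hm he
    obtain ⟨h1, h2, -⟩ := hwf _ hm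
    have h2' := qc_ne h2
    have hv : v j = v i * qc (c₁ / c₂) := by
      rw [qc_div]; field_simp; linear_combination -he
    refine ⟨?_, hv⟩
    rw [← qc_pos]
    have := hpos j
    rw [hv] at this
    exact (mul_pos_iff_of_pos_left (hpos i)).1 this
  obtain ⟨-, ⟨c₁, c₂, s, hm, he⟩ | ⟨c₁, c₂, s, hm, he⟩⟩ := h
  · obtain ⟨h1, h2⟩ := main _ _ _ _ _ hm he
    refine ⟨c₁ / c₂, ⟨c₁, c₂, i, j, s, hm, rfl⟩, h1, -1, rfl, ?_⟩
    rw [h2, mul_assoc, ← qc_mul, zpow_neg_one, mul_inv_cancel₀ h1.ne', qc_one, mul_one]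
  · obtain ⟨h1, h2⟩ := main _ _ _ _ _ hm he
    exact ⟨c₁ / c₂, ⟨c₁, c₂, j, i, s, hm, rfl⟩, h1, 1, rfl, by rw [zpow_one]; exact h2⟩

lemma H_ne {d : ℕ} {Φ : Finset (Atom1 d)} (hwf : ∀ a ∈ Φ, a.WellFormed) {q : ℚ}
    (hq : q ∈ Hset1 Φ) : q ≠ 0 := by
  obtain ⟨c₁, c₂, i, j, s, hm, rfl⟩ := hq
  obtain ⟨h1, h2, -⟩ := hwf _ hm
  exact div_ne_zero h1 h2

lemma walk_ratio {d : ℕ} {Φ : Finset (Atom1 d)} (hwf : ∀ a ∈ Φ, a.WellFormed)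
    {v : Fin d → Qstar} (hpos : ∀ i, 0 < v i) {s : ℕ} (h : Fin s → ℚ)
    (hh : ∀ q, q ∈ Hset1 Φ ↔ ∃ r, h r = q) {i j : Fin d} (p : (tightG Φ v).Walk i j) :
    ∃ e : Fin s → ℤ, (∑ r, (e r).natAbs) ≤ p.length ∧ v i = v j * qc (∏ r, |h r| ^ (e r)) := by
  induction p with
  | nil => exact ⟨fun _ => 0, by simp, by simp [qc_one]⟩
  | cons hadj p ih =>
    obtain ⟨e, he, hv⟩ := ih
    obtain ⟨q, hq, hq0, σ, hσ, hv'⟩ := adj_ratio hwf hpos hadj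
    obtain ⟨r₀, rfl⟩ := (hh q).1 hq
    refine ⟨fun r => e r + if r = r₀ then σ else 0, ?_, ?_⟩
    · rw [SimpleGraph.Walk.length_cons]
      calc ∑ r, (e r + if r = r₀ then σ else 0).natAbs
          ≤ ∑ r, ((e r).natAbs + if r = r₀ then 1 else 0) := by
            refine Finset.sum_le_sum (fun r _ => ?_)
            split_ifs <;> omega
        _ = ∑ r, (e r).natAbs + 1 := by
            rw [Finset.sum_add_distrib]; simp
        _ ≤ _ := by omega
    · rw [hv', hv, mul_assoc, ← qc_mul]
      congr 2
      have : ∀ r, |h r| ^ (e r + if r = r₀ then σ else 0)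
          = |h r| ^ (e r) * (if r = r₀ then |h r₀| ^ σ else 1) := by
        intro r
        have hne : |h r| ≠ 0 := abs_ne_zero.2 (H_ne hwf ((hh _).2 ⟨r, rfl⟩))
        rw [zpow_add₀ hne]
        split_ifs with hr
        · rw [hr]
        · simp
      simp_rw [this]
      rw [Finset.prod_mul_distrib]
      simp [abs_of_pos hq0]

lemma H_finite {d : ℕ} (Φ : Finset (Atom1 d)) : (Hset1 Φ).Finite := by
  refine (Φ.image (fun a => match a with
    | .vv c₁ c₂ _ _ _ => c₁ / c₂ | _ => 0)).finite_toSet.subset ?_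
  rintro q ⟨c₁, c₂, i, j, s, hm, rfl⟩
  simp only [Finset.coe_image, Set.mem_image]
  exact ⟨_, hm, rfl⟩

lemma vertex_in_C {d : ℕ} {Φ : Finset (Atom1 d)} (hwf : ∀ a ∈ Φ, a.WellFormed)
    {v : Fin d → Qstar} (hpos : ∀ i, 0 < v i) (ha : anchored Φ v) (i : Fin d) :
    v i ∈ Cset1 Φ ∧ v i ∈ QstarBand (-1) 1 := by
  obtain ⟨j, ⟨p⟩, c, k, st, hm, he⟩ := ha i
  have hck : c ≠ 0 ∧ k ∈ QstarBand (-1) 1 := by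
    rcases hm with hm | hm <;> exact hwf _ hm
  have hvj : v j = k / qc c := by
    rw [eq_div_iff (qc_ne hck.1), mul_comm]; exact he
  obtain ⟨s, ⟨f⟩⟩ := (H_finite Φ).exists_equiv_fin
  have hh : ∀ q, q ∈ Hset1 Φ ↔ ∃ r, ((f.symm r : Hset1 Φ) : ℚ) = q := by
    intro q
    refine ⟨fun hq => ⟨f ⟨q, hq⟩, by simp⟩, ?_⟩
    rintro ⟨r, rfl⟩; exact (f.symm r).2
  obtain ⟨e, he1, he2⟩ := walk_ratio hwf hpos (fun r => ((f.symm r : Hset1 Φ) : ℚ)) hh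
    (p.toPath : (tightG Φ v).Walk i j)
  have hlen := p.toPath.2.length_lt
  rw [Fintype.card_fin] at hlen
  constructor
  · refine ⟨v j, Or.inl ⟨c, k, j, st, hm, hvj⟩, s, _, e,
      Subtype.val_injective.comp f.symm.injective, hh, by omega, ?_⟩
    rw [qabs_pos (hpos j)]; exact he2
  · rw [he2, hvj, div_eq_mul_inv, ← qc_inv, mul_comm k, mul_comm]
    exact band_qc (band_qc hck.2)

lemma slin_band {d : ℕ} {x : Fin d → Qstar} (hx : ∀ i, x i ∈ QstarBand (-1) 1) (a : Atom1 d) :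
    slin x a ∈ QstarBand (-1) 1 := by
  cases a with
  | vv c₁ c₂ i j s => exact band_sub (band_qc (hx j)) (band_qc (hx i))
  | vk c k i s => exact band_neg (band_qc (hx i))
  | kv k c i s => exact band_qc (hx i)

lemma slack_band {d : ℕ} {x : Fin d → Qstar} (hx : ∀ i, x i ∈ QstarBand (-1) 1) {a : Atom1 d}
    (ha : a.WellFormed) : slack x a ∈ QstarBand (-1) 1 := by
  cases a with
  | vv c₁ c₂ i j s => exact band_sub (band_qc (hx j)) (band_qc (hx i))
  | vk c k i s => exact band_sub ha.2 (band_qc (hx i))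
  | kv k c i s => exact band_sub (band_qc (hx i)) ha.2

lemma sign_transfer {A p q : Qstar} (h1 : 0 < p → 0 < q) (h2 : p < 0 → q < 0) :
    0 < A * p → 0 < A * q := by
  intro h
  rcases mul_pos_iff.1 h with h | h
  · exact mul_pos h.1 (h1 h.2)
  · exact mul_pos_of_neg_of_neg h.1 (h2 h.2)

lemma zero_transfer {A p q : Qstar} (h0 : p = 0 → q = 0) : A * p = 0 → A * q = 0 := by
  intro h
  rcases mul_eq_zero.1 h with h | h
  · rw [h, zero_mul]
  · rw [h0 h, mul_zero]

lemma qc_sub (a b : ℚ) : qc (a - b) = qc a - qc b := map_sub HahnSeries.C a b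
lemma qc_zero : qc 0 = 0 := map_zero HahnSeries.C

lemma qc_neg' {c : ℚ} (h : c < 0) : qc c < 0 := by
  have h1 : 0 < qc (0 - c) := qc_pos.2 (by linarith)
  rw [qc_sub, qc_zero] at h1
  linarith

/-- At a positive vertex `v` of the closure, there is a direction entering the solution set. -/
lemma perturb {d : ℕ} {Φ : Finset (Atom1 d)} (hwf : ∀ a ∈ Φ, a.WellFormed)
    {s : Fin d → Qstar} (hs : ∀ a ∈ Φ, a.Holds QstarLt s)
    {v : Fin d → Qstar} (hv : inP Φ v) (hpos : ∀ i, 0 < v i)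
    (hband : ∀ i, v i ∈ QstarBand (-1) 1) :
    ∃ n : Fin d → ℤ, (∀ i, -(d : ℤ) ≤ n i ∧ n i ≤ d) ∧
      ∀ a ∈ Φ, a.Holds QstarLt (fun i => v i + eps ^ 3 * (qc (n i : ℚ) * v i)) := by
  let m : Fin d → Qstar := fun i => (s i - v i) / v i
  have hm : ∀ i, s i - v i = m i * v i := fun i => (div_mul_cancel₀ _ (hpos i).ne').symm
  obtain ⟨n, hn, hlt, heq, hp, hng, hz⟩ := rank_exists m
  refine ⟨n, hn, fun a ha => ?_⟩
  have hq : ∀ i j, m i < m j → 0 < qc (n j : ℚ) - qc (n i : ℚ) := by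
    intro i j h
    rw [← qc_sub, qc_pos, sub_pos]
    exact_mod_cast hlt i j h
  rw [holds_iff, slack_add v (fun i => qc (n i : ℚ) * v i)]
  have hsa := (holds_iff s a).1 (hs a ha)
  by_cases h0 : slack v a = 0
  · have hs1 : slack s a = slin (fun i => m i * v i) a := by
      have := slin_sub s v a
      rw [h0, sub_zero] at this
      rw [← this]; congr 1; funext i; exact hm i
    rw [hs1] at hsa
    rw [h0, zero_add]
    have key : (0 < slin (fun i => m i * v i) a → 0 < slin (fun i => qc (n i : ℚ) * v i) a) ∧
        (slin (fun i => m i * v i) a = 0 → slin (fun i => qc (n i : ℚ) * v i) a = 0) := by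
      have h1 : ∀ i, 0 < m i → 0 < qc (n i : ℚ) := fun i h => by
        rw [qc_pos]; exact_mod_cast hp i h
      have h2 : ∀ i, m i < 0 → qc (n i : ℚ) < 0 := fun i h =>
        qc_neg' (by exact_mod_cast hng i h)
      have h3 : ∀ i, m i = 0 → qc (n i : ℚ) = 0 := fun i h => by
        rw [hz i h, Int.cast_zero, qc_zero]
      cases a with
      | vv c₁ c₂ i j st =>
        simp only [slack, slin] at h0 ⊢
        have e : ∀ f : Fin d → Qstar, qc c₂ * (f j * v j) - qc c₁ * (f i * v i)
            = (qc c₂ * v j) * (f j - f i) := fun f => by linear_combination f i * h0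
        rw [e m, e (fun i => qc (n i : ℚ))]
        refine ⟨sign_transfer (fun h => hq i j (sub_pos.1 h)) (fun h => ?_),
          zero_transfer (fun h => ?_)⟩
        · have := hq j i (sub_neg.1 h); linarith
        · rw [heq j i (sub_eq_zero.1 h), sub_self]
      | vk c k i st =>
        simp only [slin]
        have e : ∀ f : Fin d → Qstar, - (qc c * (f i * v i)) = (- (qc c * v i)) * f i :=
          fun f => by ring
        rw [e m, e (fun i => qc (n i : ℚ))]
        exact ⟨sign_transfer (h1 i) (h2 i), zero_transfer (h3 i)⟩
      | kv k c i st =>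
        simp only [slin]
        have e : ∀ f : Fin d → Qstar, (qc c * (f i * v i)) = (qc c * v i) * f i :=
          fun f => by ring
        rw [e m, e (fun i => qc (n i : ℚ))]
        exact ⟨sign_transfer (h1 i) (h2 i), zero_transfer (h3 i)⟩
    exact ⟨fun h => mul_pos eps3_pos (key.1 (hsa.1 h)), fun h => by
      rw [key.2 (hsa.2 h), mul_zero]⟩
  · refine ⟨fun _ => ?_, fun h => absurd ((hv a ha).2 h) h0⟩
    rw [mul_comm]
    exact pos_perturb (slack_band hband (hwf a ha)) (slin_band (fun i => band_qc (hband i)) a)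
      (lt_of_le_of_ne (hv a ha).1 (Ne.symm h0))

lemma sum_lin {d : ℕ} (α : Fin d → ℚ) (x w : Fin d → Qstar) (t : Qstar) :
    ∑ i, qc (α i) * (x i + t * w i) = ∑ i, qc (α i) * x i + t * ∑ i, qc (α i) * w i := by
  rw [Finset.mul_sum, ← Finset.sum_add_distrib]
  exact Finset.sum_congr rfl (fun i _ => by ring)

/-- Solutions can be moved slightly away from another solution. -/
lemma move_away {d : ℕ} {Φ : Finset (Atom1 d)} {s x : Fin d → Qstar}
    (hs : ∀ a ∈ Φ, a.Holds QstarLt s) (hx : ∀ a ∈ Φ, a.Holds QstarLt x) :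
    ∃ t : Qstar, 0 < t ∧ ∀ a ∈ Φ, a.Holds QstarLt (fun i => s i + t * (s i - x i)) := by
  obtain ⟨t, ht, h⟩ := small_step (Φ.filter isStrict) (slack s)
    (fun a => slack s a - slack x a) (fun a ha => by
      rw [Finset.mem_filter] at ha
      exact ((holds_iff s a).1 (hs a ha.1)).1 ha.2)
  refine ⟨t, ht, fun a ha => ?_⟩
  rw [holds_iff, slack_add s (fun i => s i - x i), slin_sub]
  refine ⟨fun h' => h t ht le_rfl a (Finset.mem_filter.2 ⟨ha, h'⟩), fun h' => ?_⟩
  rw [((holds_iff s a).1 (hs a ha)).2 h', ((holds_iff x a).1 (hx a ha)).2 h']; ring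

/-- Suppose every solution of `Φ` in `ℚ((ε))` lies in `(l, r)^d` for some
`0 < l < r`. Let `α₁,…,α_d` be rationals and `u ∈ ℚ^⋆_{−1,1}`. If `Φ` has a
solution with `Σ αᵢxᵢ ≤ u`, then `Φ` has a solution with all values in
`C^⋆_{Φ,d}` and `Σ αᵢx'ᵢ ≤ u`. -/
theorem solution_in_Cstar1 {d : ℕ} (hd : 1 ≤ d) (Φ : Finset (Atom1 d))
    (hwf : ∀ a ∈ Φ, a.WellFormed)
    (l r : Qstar) (hl : QstarLt 0 l) (hlr : QstarLt l r)
    (hbound : ∀ x : Fin d → Qstar, (∀ a ∈ Φ, a.Holds QstarLt x) →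
      ∀ i, QstarLt l (x i) ∧ QstarLt (x i) r)
    (α : Fin d → ℚ) (u : Qstar) (hu : u ∈ QstarBand (-1) 1)
    (hsol : ∃ x : Fin d → Qstar, (∀ a ∈ Φ, a.Holds QstarLt x) ∧
      QstarLe (∑ i, qc (α i) * x i) u) :
    ∃ x : Fin d → Qstar, (∀ i, x i ∈ CstarSet1 Φ) ∧
      (∀ a ∈ Φ, a.Holds QstarLt x) ∧ QstarLe (∑ i, qc (α i) * x i) u := by
  rw [qlt_iff] at hl
  obtain ⟨s, hs, hsu⟩ := hsol
  rw [qle_iff] at hsu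
  -- core: from any solution `s`, a perturbed vertex
  have core : ∀ s : Fin d → Qstar, (∀ a ∈ Φ, a.Holds QstarLt s) →
      ∃ v x : Fin d → Qstar, ∑ i, qc (α i) * v i ≤ ∑ i, qc (α i) * s i ∧
        (∀ i, x i ∈ CstarSet1 Φ) ∧ (∀ a ∈ Φ, a.Holds QstarLt x) ∧
        (∑ i, qc (α i) * v i < u → ∑ i, qc (α i) * x i < u) := by
    intro s hs
    have hb : ∀ x, inP Φ x → ∀ i, l ≤ x i ∧ x i ≤ r := fun x hx => inP_bound hbound hs hx
    have hsP : inP Φ s := by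
      intro a ha
      have h := (holds_iff s a).1 (hs a ha)
      refine ⟨?_, h.2⟩
      by_cases hst : isStrict a
      · exact (h.1 hst).le
      · exact (h.2 hst).ge
    obtain ⟨v, hv, hvs, hanc⟩ := vertex_exists hl hb α _ s hsP le_rfl
    have hpos : ∀ i, 0 < v i := fun i => hl.trans_le (hb v hv i).1
    have hC := vertex_in_C hwf hpos hanc
    obtain ⟨n, hn, hx⟩ := perturb hwf hs hv hpos (fun i => (hC i).2)
    refine ⟨v, _, hvs, fun i => ⟨v i, (hC i).1, n i, (hn i).1, (hn i).2, ?_⟩, hx, fun hlt => ?_⟩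
    · ring
    · rw [sum_lin α v (fun i => qc (n i : ℚ) * v i)]
      have h1 : u - ∑ i, qc (α i) * v i ∈ QstarBand (-1) 1 :=
        band_sub hu (band_sum _ _ (fun i => band_qc (hC i).2))
      have h2 : - ∑ i, qc (α i) * (qc (n i : ℚ) * v i) ∈ QstarBand (-1) 1 :=
        band_neg (band_sum _ _ (fun i => band_qc (band_qc (hC i).2)))
      have := pos_perturb h1 h2 (sub_pos.2 hlt)
      linarith
  by_cases hex : ∃ s : Fin d → Qstar, (∀ a ∈ Φ, a.Holds QstarLt s) ∧ ∑ i, qc (α i) * s i < u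
  · obtain ⟨s', hs', hlt⟩ := hex
    obtain ⟨v, x, h1, h2, h3, h4⟩ := core s' hs'
    exact ⟨x, h2, h3, (qle_iff _ _).2 (h4 (h1.trans_lt hlt)).le⟩
  · push Not at hex
    obtain ⟨v, x, -, h2, h3, -⟩ := core s hs
    refine ⟨x, h2, h3, (qle_iff _ _).2 ?_⟩
    by_contra hc
    push Not at hc
    obtain ⟨t, ht, hy⟩ := move_away hs h3
    have h5 := hex _ hy
    rw [sum_lin α s (fun i => s i - x i)] at h5
    have h6 : ∑ i, qc (α i) * (s i - x i) = ∑ i, qc (α i) * s i - ∑ i, qc (α i) * x i := by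
      rw [← Finset.sum_sub_distrib]
      exact Finset.sum_congr rfl (fun i _ => by ring)
    rw [h6] at h5
    have h7 : t * (∑ i, qc (α i) * s i - ∑ i, qc (α i) * x i) < 0 :=
      mul_neg_of_pos_of_neg ht (by linarith)
    linarith
end
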